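/- arXiv:1711.08332 — 2 statements merged into one kernel-verified Lean document; each statement's English description precedes it below -/
import Mathlib

section
/- Suppose the family (R_n)_{n\ge 0} satisfies Assumption R with parameter \beta \ge 0. Then there exists a constant C > 0 such that for every \varphi \in L^2(\mathbb{R}\times\mathbb{T}^3) one has \|R*\varphi\|_{L^2(\mathbb{R}\times\mathbb{T}^3)} \le C\,\|\varphi\|_{L^2(\mathbb{R}\times\mathbb{T}^3)}, where R*\varphi := \sum_{n\ge 0} R_n*\varphi and each R_n*\varphi is the convolution on \mathbb{R}\times\mathbb{R}^3 of R_n with the spatially periodic extension of \varphi (which is again periodic, hence a function on \mathbb{R}\times\mathbb{T}^3). -/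
open MeasureTheory Filter Topology

noncomputable section

/-- Parabolic scaling exponents s = (2,1,1,1). -/
def sExp : Fin 4 → ℕ := ![2, 1, 1, 1]

/-- Parabolically scaled norm |z|_s = max_i |z_i|^(1/s_i). -/
def snorm4 (z : Fin 4 → ℝ) : ℝ := ⨆ i, |z i| ^ ((sExp i : ℝ)⁻¹)

/-- Scaling action l · z = (l^(s_i) z_i)_i. -/
def scl (l : ℝ) (z : Fin 4 → ℝ) : Fin 4 → ℝ := fun i => l ^ (sExp i) * z i

/-- Scaled size |k|_s = ∑ s_i k_i of a multi-index. -/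
def ksize (k : Fin 4 → ℕ) : ℝ := ∑ i, (sExp i : ℝ) * (k i : ℝ)

/-- Partial derivative in direction i. -/
def pderiv1 (i : Fin 4) (f : (Fin 4 → ℝ) → ℝ) : (Fin 4 → ℝ) → ℝ :=
  fun z => fderiv ℝ f z (Pi.single i 1)

/-- Iterated partial derivative ∂^k. -/
def pderivM (k : Fin 4 → ℕ) (f : (Fin 4 → ℝ) → ℝ) : (Fin 4 → ℝ) → ℝ :=
  ((pderiv1 0)^[k 0] ∘ (pderiv1 1)^[k 1] ∘ (pderiv1 2)^[k 2] ∘ (pderiv1 3)^[k 3]) f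

/-- Assumption R from the paper: the R_n are even smooth functions, R_n is supported in a
parabolic ball of radius C₀ 2^(-n), the derivative ∂^k R_n is bounded by
C_k 2^(n(|s| + |k|_s - β)) (with |s| = 5), and if β = 0 then R_n integrates to zero
for n ≥ 1. -/
structure AssumptionR (R : ℕ → (Fin 4 → ℝ) → ℝ) (β : ℝ) : Prop where
  beta_nonneg : 0 ≤ β
  even : ∀ n z, R n (-z) = R n z
  smooth : ∀ n, ContDiff ℝ (⊤ : ℕ∞) (R n)
  support : ∃ C0 > 0, ∀ n z, R n z ≠ 0 → snorm4 z ≤ C0 * (2 : ℝ) ^ (-(n : ℝ))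
  deriv_bound : ∀ k : Fin 4 → ℕ, ∃ Ck > 0, ∀ n z,
    |pderivM k (R n) z| ≤ Ck * (2 : ℝ) ^ ((n : ℝ) * (5 + ksize k - β))
  mean_zero : β = 0 → ∀ n, 1 ≤ n → (∫ z, R n z) = 0

/-- Fourier transform on ℝ⁴ with convention e^(-i⟨ξ,z⟩). -/
def ft (f : (Fin 4 → ℝ) → ℝ) (ξ : Fin 4 → ℝ) : ℂ :=
  ∫ z : Fin 4 → ℝ, Complex.exp (-Complex.I * ((∑ i, ξ i * z i : ℝ) : ℂ)) * (f z : ℂ)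

/-- The parabolic annulus A_n^C. -/
def AnC (C : ℝ) (n : ℕ) : Set (Fin 4 → ℝ) :=
  {ξ | C⁻¹ * 2 ^ n ≤ snorm4 ξ ∧ snorm4 ξ ≤ C * 2 ^ n}

/-- The set B_n^C. -/
def BnC (C : ℝ) (n : ℕ) : Set ((Fin 4 → ℝ) × (Fin 4 → ℝ)) :=
  {p | p.1 ∈ AnC C n ∧ p.2 ∈ AnC C n ∧ p.1 + p.2 ∈ AnC C n}

/-- Integration of a nonnegative function against the measure m̂, given by
(1/2π) ∫ dξ₀ ∑_(k ∈ ℤ³) f(ξ₀, 2πk₁, 2πk₂, 2πk₃). -/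
def mIntegral (f : (Fin 4 → ℝ) → ENNReal) : ENNReal :=
  ENNReal.ofReal (1 / (2 * Real.pi)) *
    ∫⁻ t : ℝ, ∑' k : Fin 3 → ℤ, f (Fin.cons t (fun j => 2 * Real.pi * (k j : ℝ)))

/-- Fundamental domain for ℝ × 𝕋³: space coordinates in [0,1). -/
def fundDom : Set (Fin 4 → ℝ) := {z | ∀ i : Fin 3, z i.succ ∈ Set.Ico (0 : ℝ) 1}

open scoped FourierTransform ENNReal SchwartzMap

/-- A Schwartz kernel whose Fourier transform is bounded by `C` acts on Schwartz functions by
convolution with `L²` operator norm at most `C`. -/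
lemma SchwartzMap.eLpNorm_convolution_le {E : Type*} [NormedAddCommGroup E]
    [InnerProductSpace ℝ E] [FiniteDimensional ℝ E] [MeasurableSpace E] [BorelSpace E]
    {C : ℝ} (k f : 𝓢(E, ℂ)) (hk : ∀ ξ, ‖𝓕 k ξ‖ ≤ C) :
    eLpNorm (fun x => ∫ y, k y * f (x - y)) 2 volume ≤ ENNReal.ofReal C * eLpNorm f 2 volume := by
  have hC : 0 ≤ C := (norm_nonneg _).trans (hk 0)
  set h : 𝓢(E, ℂ) := SchwartzMap.convolution (ContinuousLinearMap.mul ℂ ℂ) k f with hh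
  have hfun : (fun x => ∫ y, k y * f (x - y)) = h := by
    ext x
    rw [hh, SchwartzMap.convolution_apply]
    rfl
  have hnorm : ‖h.toLp 2‖ ≤ C * ‖f.toLp 2‖ := by
    have hP : ∀ g : 𝓢(E, ℂ), ‖g.toLp 2 volume‖ = ‖(𝓕 g).toLp 2 volume‖ := fun g => by
      rw [← SchwartzMap.toLp_fourier_eq]
      exact (Lp.norm_fourier_eq (g.toLp 2 volume)).symm
    rw [hP h, hP f]
    refine Lp.norm_le_mul_norm_of_ae_le_mul ?_
    filter_upwards [(𝓕 h).coeFn_toLp 2, (𝓕 f).coeFn_toLp 2] with ξ h1 h2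
    rw [h1, h2, hh, SchwartzMap.fourier_convolution, SchwartzMap.pairing_apply_apply]
    simp only [ContinuousLinearMap.mul_apply', norm_mul]
    gcongr
    exact hk ξ
  rw [hfun]
  rw [SchwartzMap.norm_toLp, SchwartzMap.norm_toLp] at hnorm
  rw [← ENNReal.ofReal_toReal (h.memLp 2 volume).eLpNorm_ne_top,
    ← ENNReal.ofReal_toReal (f.memLp 2 volume).eLpNorm_ne_top, ← ENNReal.ofReal_mul hC]
  exact ENNReal.ofReal_le_ofReal hnorm

/-- The Cauchy–Schwarz bound for a convolution at a point. -/
lemma enorm_convolution_le {E : Type*} [NormedAddCommGroup E]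
    [InnerProductSpace ℝ E] [FiniteDimensional ℝ E] [MeasurableSpace E] [BorelSpace E]
    {k f : E → ℂ} (hk : AEStronglyMeasurable k volume) (hf : AEStronglyMeasurable f volume)
    (x : E) :
    ‖∫ y, k y * f (x - y)‖ₑ ≤ eLpNorm k 2 volume * eLpNorm f 2 volume := by
  have hp := Measure.measurePreserving_sub_left (volume : Measure E) x
  have h1 : eLpNorm (fun y => f (x - y)) 2 volume = eLpNorm f 2 volume :=
    eLpNorm_comp_measurePreserving hf hp
  calc ‖∫ y, k y * f (x - y)‖ₑ ≤ ∫⁻ y, ‖k y * f (x - y)‖ₑ := enorm_integral_le_lintegral_enorm _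
    _ = eLpNorm (k • fun y => f (x - y)) 1 volume := by
      rw [eLpNorm_one_eq_lintegral_enorm]; rfl
    _ ≤ eLpNorm k 2 volume * eLpNorm (fun y => f (x - y)) 2 volume :=
      eLpNorm_smul_le_mul_eLpNorm (hf.comp_measurePreserving hp) hk
    _ = _ := by rw [h1]

/-- A Schwartz kernel whose Fourier transform is bounded by `C` acts on `L²` by convolution with
operator norm at most `C`. -/
lemma SchwartzMap.eLpNorm_convolution_le_of_memLp {E : Type*} [NormedAddCommGroup E]
    [InnerProductSpace ℝ E] [FiniteDimensional ℝ E] [MeasurableSpace E] [BorelSpace E]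
    {C : ℝ} (k : 𝓢(E, ℂ)) (hk : ∀ ξ, ‖𝓕 k ξ‖ ≤ C) {f : E → ℂ} (hf : MemLp f 2 volume) :
    eLpNorm (fun x => ∫ y, k y * f (x - y)) 2 volume ≤ ENNReal.ofReal C * eLpNorm f 2 volume := by
  obtain ⟨u, hu, hlim⟩ := mem_closure_iff_seq_limit.1
    (SchwartzMap.denseRange_toLpCLM (E := E) (F := ℂ) (μ := volume) (p := 2)
      ENNReal.ofNat_ne_top (hf.toLp f))
  choose g hg using hu
  have hkm := k.memLp 2 (volume : Measure E)
  have hgm := fun j => (g j).memLp 2 (volume : Measure E)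
  have hdist : Tendsto (fun j => eLpNorm (⇑(g j) - f) 2 volume) atTop (𝓝 0) := by
    have h0 := (Lp.tendsto_Lp_iff_tendsto_eLpNorm' u (hf.toLp f)).1 hlim
    refine h0.congr fun j => eLpNorm_congr_ae ?_
    filter_upwards [(g j).coeFn_toLp 2 volume, hf.coeFn_toLp] with x h1 h2
    rw [Pi.sub_apply, Pi.sub_apply, h2, ← h1, ← hg j]
    rfl
  have hint : ∀ {w : E → ℂ}, MemLp w 2 volume → ∀ x, Integrable (fun y => k y * w (x - y)) := by
    intro w hw x
    have := hw.comp_measurePreserving (Measure.measurePreserving_sub_left (volume : Measure E) x)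
    exact hkm.integrable_mul this
  have hpt : ∀ x, Tendsto (fun j => ∫ y, k y * g j (x - y)) atTop (𝓝 (∫ y, k y * f (x - y))) := by
    intro x
    rw [tendsto_iff_edist_tendsto_0]
    have hb : Tendsto (fun j => eLpNorm k 2 volume * eLpNorm (⇑(g j) - f) 2 volume) atTop
        (𝓝 0) := by
      simpa using ENNReal.Tendsto.const_mul hdist (Or.inr hkm.eLpNorm_ne_top)
    refine tendsto_of_tendsto_of_tendsto_of_le_of_le tendsto_const_nhds hb
      (fun _ => zero_le) fun j => ?_
    · simp only [edist_eq_enorm_sub]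
      rw [← integral_sub (hint (hgm j) x) (hint hf x)]
      simp only [← mul_sub]
      exact enorm_convolution_le hkm.1 ((hgm j).sub hf).1 x
  have hmeas : ∀ j, AEStronglyMeasurable (fun x => ∫ y, k y * g j (x - y)) volume := by
    intro j
    have : (fun x => ∫ y, k y * g j (x - y)) =
        ⇑(SchwartzMap.convolution (ContinuousLinearMap.mul ℂ ℂ) k (g j)) := by
      ext x
      rw [SchwartzMap.convolution_apply]
      rfl
    rw [this]
    exact (SchwartzMap.continuous _).aestronglyMeasurable
  calc eLpNorm (fun x => ∫ y, k y * f (x - y)) 2 volume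
      ≤ liminf (fun j => eLpNorm (fun x => ∫ y, k y * g j (x - y)) 2 volume) atTop :=
        Lp.eLpNorm_lim_le_liminf_eLpNorm hmeas _ (Eventually.of_forall hpt)
    _ ≤ liminf (fun j => ENNReal.ofReal C *
          (eLpNorm (⇑(g j) - f) 2 volume + eLpNorm f 2 volume)) atTop := by
        refine liminf_le_liminf (Eventually.of_forall fun j => ?_)
        refine (SchwartzMap.eLpNorm_convolution_le k (g j) hk).trans ?_
        gcongr
        have := eLpNorm_add_le ((hgm j).sub hf).1 hf.1 (one_le_two : (1 : ℝ≥0∞) ≤ 2)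
        rwa [sub_add_cancel] at this
    _ = ENNReal.ofReal C * (0 + eLpNorm f 2 volume) := by
        refine Tendsto.liminf_eq ?_
        exact ENNReal.Tendsto.const_mul (hdist.add tendsto_const_nhds) (Or.inr ENNReal.ofReal_ne_top)
    _ = _ := by rw [zero_add]

/-- Convolution with a kernel on `ℝ⁴` whose Fourier transform is bounded by `C` has norm at most
`C` on `L²`. -/
lemma eLpNorm_convolution_pi_le {C : ℝ} (k : 𝓢(EuclideanSpace ℝ (Fin 4), ℂ))
    (hk : ∀ ξ, ‖𝓕 k ξ‖ ≤ C) {K : (Fin 4 → ℝ) → ℝ} (hK : ∀ x, k x = (K x.ofLp : ℂ))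
    {f : (Fin 4 → ℝ) → ℝ} (hf : MemLp f 2 volume) :
    eLpNorm (fun z => ∫ y, K y * f (z - y)) 2 volume ≤ ENNReal.ofReal C * eLpNorm f 2 volume := by
  have hp := PiLp.volume_preserving_ofLp (Fin 4)
  have he : MeasurableEmbedding (WithLp.ofLp : EuclideanSpace ℝ (Fin 4) → Fin 4 → ℝ) :=
    (MeasurableEquiv.toLp 2 (Fin 4 → ℝ)).symm.measurableEmbedding
  have hcomp : ∀ u : (Fin 4 → ℝ) → ℝ,
      eLpNorm u 2 volume = eLpNorm (fun x : EuclideanSpace ℝ (Fin 4) => (u x.ofLp : ℂ)) 2 volume := by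
    intro u
    rw [← hp.map_eq, he.eLpNorm_map_measure]
    exact eLpNorm_congr_norm_ae (Eventually.of_forall fun x => by simp)
  have hf' : MemLp (fun x : EuclideanSpace ℝ (Fin 4) => (f x.ofLp : ℂ)) 2 volume :=
    (hf.comp_measurePreserving hp).ofReal
  rw [hcomp, hcomp f]
  convert k.eLpNorm_convolution_le_of_memLp hk hf' using 2
  ext x
  rw [← integral_complex_ofReal, ← hp.integral_comp he]
  simp [hK]

/-- A function bounded by `A` and supported in the parabolic box of radius `r` has `L¹` norm at most
`A` times the volume of the box. -/
lemma integral_norm_le_of_support_box {h : EuclideanSpace ℝ (Fin 4) → ℂ} {A r : ℝ} (hA : 0 ≤ A)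
    (hr : 0 ≤ r) (hb : ∀ x, ‖h x‖ ≤ A) (hs : ∀ x, h x ≠ 0 → ∀ i, |x i| ≤ r ^ sExp i) :
    ∫ x, ‖h x‖ ≤ A * (16 * r ^ 5) := by
  set b : Fin 4 → ℝ := fun i => r ^ sExp i with hbdef
  set S : Set (EuclideanSpace ℝ (Fin 4)) := WithLp.ofLp ⁻¹' Set.Icc (-b) b with hS
  have hp := PiLp.volume_preserving_ofLp (Fin 4)
  have hSm : MeasurableSet S := hp.measurable measurableSet_Icc
  have hb0 : -b ≤ b := by
    intro i
    have : 0 ≤ b i := pow_nonneg hr _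
    simp only [Pi.neg_apply]
    linarith
  have hvS : volume S = volume (Set.Icc (-b) b) :=
    hp.measure_preimage measurableSet_Icc.nullMeasurableSet
  have hvol : (volume S).toReal = 16 * r ^ 5 := by
    rw [hvS, Real.volume_Icc_pi_toReal hb0]
    simp [Fin.prod_univ_four, hbdef, sExp]
    ring
  have hfin : volume S ≠ ⊤ := by
    rw [hvS]
    exact isCompact_Icc.measure_ne_top
  calc ∫ x, ‖h x‖ ≤ ∫ x, S.indicator (fun _ => A) x := by
        refine integral_mono_of_nonneg (Eventually.of_forall fun x => norm_nonneg _)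
          ((integrableOn_const hfin).integrable_indicator hSm)
          (Eventually.of_forall fun x => ?_)
        by_cases hx : h x = 0
        · simp only [hx, norm_zero]
          exact Set.indicator_nonneg (fun _ _ => hA) x
        · have : x ∈ S := by
            rw [hS, Set.mem_preimage, Set.mem_Icc]
            exact ⟨fun i => (abs_le.1 (hs x hx i)).1, fun i => (abs_le.1 (hs x hx i)).2⟩
          simpa [Set.indicator_of_mem this] using hb x
    _ = A * (16 * r ^ 5) := by
        rw [integral_indicator hSm, setIntegral_const, smul_eq_mul, measureReal_def, hvol, mul_comm]

/-- If `g` has integral zero and is supported in the parabolic box of radius `r`, its Fourier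
transform vanishes at the origin at first order. -/
lemma norm_fourier_le_of_integral_eq_zero {g : EuclideanSpace ℝ (Fin 4) → ℂ} {A r : ℝ}
    (hA : 0 ≤ A) (hr : 0 ≤ r) (hg : Integrable g) (h0 : ∫ x, g x = 0) (hb : ∀ x, ‖g x‖ ≤ A)
    (hs : ∀ x, g x ≠ 0 → ∀ i, |x i| ≤ r ^ sExp i) (ξ : EuclideanSpace ℝ (Fin 4)) :
    ‖𝓕 g ξ‖ ≤ (2 * Real.pi * ∑ i, |ξ i| * r ^ sExp i) * A * (16 * r ^ 5) := by
  have hint : Integrable fun x => Real.fourierChar (-inner ℝ x ξ) • g x := by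
    simpa using (Real.fourierIntegral_convergent_iff ξ).2 hg
  have hsub : 𝓕 g ξ = ∫ x, (Real.fourierChar (-inner ℝ x ξ) • g x - g x) := by
    rw [integral_sub hint hg, h0, sub_zero, Real.fourier_eq]
  rw [hsub]
  refine (norm_integral_le_integral_norm _).trans
    (integral_norm_le_of_support_box (by positivity) hr (fun x => ?_) fun x hx => hs x ?_)
  · by_cases hx : g x = 0
    · simp only [hx, smul_zero, sub_zero, norm_zero]
      positivity
    · have hxs := hs x hx
      have hinner : |inner ℝ x ξ| ≤ ∑ i, |ξ i| * r ^ sExp i := by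
        rw [PiLp.inner_apply]
        refine (Finset.abs_sum_le_sum_abs _ _).trans (Finset.sum_le_sum fun i _ => ?_)
        simp only [RCLike.inner_apply, conj_trivial, abs_mul]
        gcongr
        exact hxs i
      have hexp : ‖((Real.fourierChar (-inner ℝ x ξ) : Circle) : ℂ) - 1‖ ≤
          2 * Real.pi * |inner ℝ x ξ| := by
        have := Real.norm_exp_I_mul_ofReal_sub_one_le (x := 2 * Real.pi * -inner ℝ x ξ)
        rw [Real.fourierChar_apply, mul_comm _ Complex.I]
        refine this.trans (le_of_eq ?_)
        rw [Real.norm_eq_abs, abs_mul, abs_neg, abs_of_pos Real.two_pi_pos]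
      have : Real.fourierChar (-inner ℝ x ξ) • g x - g x =
          (((Real.fourierChar (-inner ℝ x ξ) : Circle) : ℂ) - 1) * g x := by
        rw [sub_mul, one_mul, Circle.smul_def, smul_eq_mul]
      rw [this, norm_mul]
      gcongr
      · exact hexp.trans (by gcongr)
      · exact hb x
  · rintro h
    simp [h] at hx

/-- A sum over a geometric progression of the profile `x / (1 + x)²` is bounded. -/
lemma sum_div_one_add_sq_le {a l : ℝ} (ha : 0 ≤ a) (hl0 : 0 ≤ l) (hl : l ≤ 1 / 2) (N : ℕ) :
    ∑ n ∈ Finset.range N, a * l ^ n / (1 + a * l ^ n) ^ 2 ≤ 2 := by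
  set p : ℕ → ℝ := fun n => a * l ^ n / (1 + a * l ^ n) with hp
  have key : ∀ n, a * l ^ n / (1 + a * l ^ n) ^ 2 ≤ 2 * (p n - p (n + 1)) := by
    intro n
    simp only [hp, pow_succ l n, ← mul_assoc]
    set x := a * l ^ n with hx
    have hx0 : 0 ≤ x := by positivity
    have hxl : x * l ≤ x / 2 := by nlinarith
    have h1 : x * l / (1 + x * l) ≤ (x / 2) / (1 + x / 2) := by
      rw [div_le_div_iff₀ (by positivity) (by positivity)]
      nlinarith
    have h2 : x / (1 + x) ^ 2 ≤ 2 * (x / (1 + x) - (x / 2) / (1 + x / 2)) := by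
      have : 2 * (x / (1 + x) - (x / 2) / (1 + x / 2)) = x / ((1 + x) * (1 + x / 2)) := by
        field_simp
        ring
      rw [this]
      apply div_le_div_of_nonneg_left hx0 (by positivity)
      nlinarith
    linarith
  calc _ ≤ ∑ n ∈ Finset.range N, 2 * (p n - p (n + 1)) := Finset.sum_le_sum fun n _ => key n
    _ = 2 * (p 0 - p N) := by rw [← Finset.mul_sum, Finset.sum_range_sub']
    _ ≤ 2 := by
      have h0 : p 0 ≤ 1 := by
        simp only [hp, pow_zero, mul_one]
        rw [div_le_one (by positivity)]
        linarith
      have hN : 0 ≤ p N := by positivity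
      linarith

/-- A quantity bounded by `B * ∑ xᵢ` and by `B / xᵢ` for every `i` is controlled by the profiles
`xᵢ / (1 + xᵢ)²`. -/
lemma le_sum_div_one_add_sq {v B : ℝ} (hv : 0 ≤ v) (hB : 0 ≤ B) {x : Fin 4 → ℝ} (hx : ∀ i, 0 ≤ x i)
    (hlow : v ≤ B * ∑ i, x i) (hhigh : ∀ i, x i * v ≤ B) :
    v ≤ 13 * B * ∑ i, x i / (1 + x i) ^ 2 := by
  obtain ⟨i, hi⟩ := Finite.exists_max x
  have hsum : ∑ j, x j ≤ 4 * x i := by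
    calc ∑ j, x j ≤ ∑ _j : Fin 4, x i := Finset.sum_le_sum fun j _ => hi j
      _ = 4 * x i := by simp
  have h1 : v ≤ 4 * (B * x i) := hlow.trans (by nlinarith)
  have h2 := hhigh i
  have hxi := hx i
  have h3 : v * x i ≤ 4 * (B * x i) := by
    rcases le_total (x i) 1 with h | h <;> nlinarith
  have h4 : v ≤ 13 * B * (x i / (1 + x i) ^ 2) := by
    rw [← mul_div_assoc, le_div_iff₀ (by positivity)]
    nlinarith [mul_le_mul_of_nonneg_right h2 hxi]
  refine h4.trans ?_
  gcongr
  exact Finset.single_le_sum (f := fun j => x j / (1 + x j) ^ 2)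
    (fun j _ => div_nonneg (hx j) (sq_nonneg _)) (Finset.mem_univ i)

lemma abs_le_of_snorm4_le {z : Fin 4 → ℝ} {r : ℝ} (hr : 0 ≤ r) (h : snorm4 z ≤ r) (i : Fin 4) :
    |z i| ≤ r ^ sExp i := by
  have h1 : |z i| ^ ((sExp i : ℝ)⁻¹) ≤ r :=
    (le_ciSup (f := fun i => |z i| ^ ((sExp i : ℝ)⁻¹)) (Set.finite_range _).bddAbove i).trans h
  have hs : (0 : ℝ) < sExp i := by fin_cases i <;> simp [sExp]
  rwa [Real.rpow_inv_le_iff_of_pos (abs_nonneg _) hr hs, Real.rpow_natCast] at h1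

lemma ksize_single (i : Fin 4) : ksize (Pi.single i 1) = sExp i := by
  simp [ksize, Pi.single_apply]

lemma ksize_zero : ksize 0 = 0 := by
  simp [ksize]

lemma pderivM_zero (f : (Fin 4 → ℝ) → ℝ) : pderivM 0 f = f := by
  simp [pderivM]

lemma pderivM_single (i : Fin 4) (f : (Fin 4 → ℝ) → ℝ) :
    pderivM (Pi.single i 1) f = pderiv1 i f := by
  fin_cases i <;> simp [pderivM]

lemma pderiv1_support_box {f : (Fin 4 → ℝ) → ℝ} {b : Fin 4 → ℝ}
    (hf : ∀ z, f z ≠ 0 → ∀ i, |z i| ≤ b i) (j : Fin 4) (z : Fin 4 → ℝ) (hz : pderiv1 j f z ≠ 0)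
    (i : Fin 4) : |z i| ≤ b i := by
  have hz' : z ∈ Function.support (fderiv ℝ f) := by
    intro h
    simp [pderiv1, h] at hz
  have hcl : IsClosed {z : Fin 4 → ℝ | ∀ i, |z i| ≤ b i} := by
    simp only [Set.ofPred_forall]
    exact isClosed_iInter fun i => isClosed_le (by fun_prop) continuous_const
  exact closure_minimal (fun w hw => hf w hw) hcl (support_fderiv_subset ℝ hz') i

lemma two_rpow_mul_box (n m : ℕ) (β c : ℝ) :
    (2 : ℝ) ^ ((n : ℝ) * (5 + m - β)) * (16 * (c * (2 : ℝ) ^ (-(n : ℝ))) ^ 5) =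
      16 * c ^ 5 * ((2 : ℝ) ^ m) ^ n * ((2 : ℝ) ^ (-β)) ^ n := by
  have h1 : (2 : ℝ) ^ ((n : ℝ) * (5 + m - β)) =
      ((2 : ℝ) ^ n) ^ 5 * ((2 : ℝ) ^ m) ^ n * ((2 : ℝ) ^ (-β)) ^ n := by
    rw [← pow_mul, ← pow_mul, ← Real.rpow_natCast, ← Real.rpow_natCast, ← Real.rpow_natCast,
      ← Real.rpow_mul zero_le_two, ← Real.rpow_add zero_lt_two, ← Real.rpow_add zero_lt_two]
    congr 1
    push_cast
    ring
  rw [h1, Real.rpow_neg zero_le_two (n : ℝ), Real.rpow_natCast]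
  field_simp

namespace AssumptionR

variable {R : ℕ → (Fin 4 → ℝ) → ℝ} {β : ℝ}

/-- The kernels, transported to Euclidean space, are Schwartz functions. -/
lemma exists_schwartz (hR : AssumptionR R β) :
    ∃ g : ℕ → 𝓢(EuclideanSpace ℝ (Fin 4), ℂ), ∀ n x, g n x = (R n x.ofLp : ℂ) := by
  obtain ⟨C0, hC0, hsupp⟩ := hR.support
  let L := PiLp.continuousLinearEquiv 2 ℝ (fun _ : Fin 4 => ℝ)
  have hcd : ∀ n, ContDiff ℝ (⊤ : ℕ∞) fun x => (R n (L x) : ℂ) := fun n =>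
    Complex.ofRealCLM.contDiff.comp ((hR.smooth n).comp L.contDiff)
  have hcs : ∀ n, HasCompactSupport fun x => (R n (L x) : ℂ) := by
    intro n
    set b : Fin 4 → ℝ := fun i => (C0 * (2 : ℝ) ^ (-(n : ℝ))) ^ sExp i
    refine HasCompactSupport.intro (K := L ⁻¹' Set.Icc (-b) b)
      (L.toHomeomorph.isCompact_preimage.2 isCompact_Icc) fun x hx => ?_
    by_contra hne
    have hne' : R n (L x) ≠ 0 := by simpa using hne
    have hb := abs_le_of_snorm4_le (by positivity) (hsupp n _ hne')
    exact hx ⟨fun i => (abs_le.1 (hb i)).1, fun i => (abs_le.1 (hb i)).2⟩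
  exact ⟨fun n => (hcs n).toSchwartzMap (hcd n), fun n x => rfl⟩

lemma lineDeriv_schwartz (hR : AssumptionR R β) {g : 𝓢(EuclideanSpace ℝ (Fin 4), ℂ)} {n : ℕ}
    (hg : ∀ x, g x = (R n x.ofLp : ℂ)) (i : Fin 4) (x : EuclideanSpace ℝ (Fin 4)) :
    LineDeriv.lineDerivOp (EuclideanSpace.single i (1 : ℝ)) g x =
      (pderiv1 i (R n) x.ofLp : ℂ) := by
  let L := PiLp.continuousLinearEquiv 2 ℝ (fun _ : Fin 4 => ℝ)
  have hgL : (g : EuclideanSpace ℝ (Fin 4) → ℂ) = fun x => Complex.ofRealCLM (R n (L x)) :=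
    funext hg
  have hd : HasFDerivAt (R n) (fderiv ℝ (R n) (L x)) (L x) :=
    ((hR.smooth n).differentiable (by simp) (L x)).hasFDerivAt
  have hd2 := Complex.ofRealCLM.hasFDerivAt.comp x (hd.comp x L.hasFDerivAt)
  rw [SchwartzMap.lineDerivOp_apply_eq_fderiv, hgL]
  change fderiv ℝ (Complex.ofRealCLM ∘ (R n ∘ L)) x _ = _
  rw [hd2.fderiv]
  simp [pderiv1, L]
  rfl

/-- Uniform decay estimates for the Fourier transforms of the kernels, at high and at low
frequencies. -/
lemma exists_fourier_decay (hR : AssumptionR R β) {g : ℕ → 𝓢(EuclideanSpace ℝ (Fin 4), ℂ)}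
    (hg : ∀ n x, g n x = (R n x.ofLp : ℂ)) :
    ∃ B, 0 ≤ B ∧ (∀ n ξ, ‖𝓕 (g n) ξ‖ ≤ B * ((2 : ℝ) ^ (-β)) ^ n) ∧
      (∀ n ξ i, |ξ i| * (((2 : ℝ) ^ sExp i)⁻¹) ^ n * ‖𝓕 (g n) ξ‖ ≤ B) ∧
      (β = 0 → ∀ n, 1 ≤ n → ∀ ξ,
        ‖𝓕 (g n) ξ‖ ≤ B * ∑ i, |ξ i| * (((2 : ℝ) ^ sExp i)⁻¹) ^ n) := by
  obtain ⟨C0, hC0, hsupp⟩ := hR.support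
  obtain ⟨D, hD, hD'⟩ := hR.deriv_bound 0
  choose E hE hE' using fun i : Fin 4 => hR.deriv_bound (Pi.single i 1)
  simp only [pderivM_zero, ksize_zero] at hD'
  simp only [pderivM_single, ksize_single] at hE'
  set r : ℕ → ℝ := fun n => C0 * (2 : ℝ) ^ (-(n : ℝ)) with hr
  have hr0 : ∀ n, 0 ≤ r n := fun n => by positivity
  have hbox : ∀ n z, R n z ≠ 0 → ∀ i, |z i| ≤ r n ^ sExp i := fun n z hz =>
    abs_le_of_snorm4_le (hr0 n) (hsupp n z hz)
  have hgbox : ∀ n x, g n x ≠ 0 → ∀ i, |x i| ≤ r n ^ sExp i := fun n x hx =>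
    hbox n x.ofLp (by simpa [hg] using hx)
  have hgbd : ∀ n x, ‖g n x‖ ≤ D * (2 : ℝ) ^ ((n : ℝ) * (5 + (0 : ℕ) - β)) := fun n x => by
    simpa [hg] using hD' n x.ofLp
  have hβ : (2 : ℝ) ^ (-β) ≤ 1 :=
    Real.rpow_le_one_of_one_le_of_nonpos one_le_two (neg_nonpos.2 hR.beta_nonneg)
  have hfour : ∀ (h : 𝓢(EuclideanSpace ℝ (Fin 4), ℂ)) ξ, ‖𝓕 h ξ‖ ≤ ∫ x, ‖h x‖ := fun h ξ => by
    rw [SchwartzMap.fourier_coe]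
    exact VectorFourier.norm_fourierIntegral_le_integral_norm _ _ _ _ _
  have hB1 : 0 ≤ 16 * D * C0 ^ 5 := by positivity
  have hB2 : 0 ≤ ∑ i, 16 * E i * C0 ^ 5 :=
    Finset.sum_nonneg fun i _ => mul_nonneg (mul_nonneg (by norm_num) (hE i).le) (by positivity)
  have hB3 : 0 ≤ 2 * Real.pi * (1 + C0) ^ 2 * (16 * D * C0 ^ 5) := by positivity
  refine ⟨16 * D * C0 ^ 5 + ∑ i, 16 * E i * C0 ^ 5 +
    2 * Real.pi * (1 + C0) ^ 2 * (16 * D * C0 ^ 5), by positivity, ?_, ?_, ?_⟩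
  · intro n ξ
    have h := (hfour (g n) ξ).trans
      (integral_norm_le_of_support_box (by positivity) (hr0 n) (hgbd n) (hgbox n))
    rw [mul_assoc, hr, two_rpow_mul_box, pow_zero, one_pow] at h
    calc _ ≤ 16 * D * C0 ^ 5 * ((2 : ℝ) ^ (-β)) ^ n := h.trans (le_of_eq (by ring))
      _ ≤ _ := by
        gcongr
        linarith
  · intro n ξ i
    set m : EuclideanSpace ℝ (Fin 4) := EuclideanSpace.single i 1 with hm
    have hF : ‖𝓕 (LineDeriv.lineDerivOp m (g n)) ξ‖ = 2 * Real.pi * |ξ i| * ‖𝓕 (g n) ξ‖ := by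
      have ht : (fun x : EuclideanSpace ℝ (Fin 4) => inner ℝ x m).HasTemperateGrowth :=
        ((innerSL ℝ).flip m).hasTemperateGrowth
      rw [SchwartzMap.fourier_lineDerivOp_eq, smul_apply,
        SchwartzMap.smulLeftCLM_apply_apply ht]
      simp [hm, EuclideanSpace.inner_single_right, abs_of_pos Real.pi_pos]
      ring
    have h := (hfour (LineDeriv.lineDerivOp m (g n)) ξ).trans
      (integral_norm_le_of_support_box (A := E i * (2 : ℝ) ^ ((n : ℝ) * (5 + sExp i - β)))
        (mul_nonneg (hE i).le (by positivity)) (hr0 n)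
        (fun x => by
          rw [hm, hR.lineDeriv_schwartz (hg n)]
          simpa using hE' i n x.ofLp)
        (fun x hx => pderiv1_support_box (hbox n) i x.ofLp (by
          rw [hm, hR.lineDeriv_schwartz (hg n)] at hx
          simpa using hx)))
    rw [hF, mul_assoc (E i), hr, two_rpow_mul_box] at h
    have hpow : ((2 : ℝ) ^ (-β)) ^ n ≤ 1 := pow_le_one₀ (by positivity) hβ
    have hEi := hE i
    have h2 : |ξ i| * ‖𝓕 (g n) ξ‖ ≤ 16 * E i * C0 ^ 5 * ((2 : ℝ) ^ sExp i) ^ n := by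
      calc |ξ i| * ‖𝓕 (g n) ξ‖ ≤ 2 * Real.pi * (|ξ i| * ‖𝓕 (g n) ξ‖) := by
            refine le_mul_of_one_le_left (by positivity) ?_
            linarith [Real.pi_gt_three]
        _ ≤ E i * (16 * C0 ^ 5 * ((2 : ℝ) ^ sExp i) ^ n * ((2 : ℝ) ^ (-β)) ^ n) := by
            rw [← mul_assoc]
            exact h
        _ ≤ E i * (16 * C0 ^ 5 * ((2 : ℝ) ^ sExp i) ^ n * 1) := by gcongr
        _ = _ := by ring
    calc |ξ i| * (((2 : ℝ) ^ sExp i)⁻¹) ^ n * ‖𝓕 (g n) ξ‖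
        = |ξ i| * ‖𝓕 (g n) ξ‖ / ((2 : ℝ) ^ sExp i) ^ n := by
          rw [inv_pow]
          ring
      _ ≤ 16 * E i * C0 ^ 5 := by
          rw [div_le_iff₀ (by positivity)]
          exact h2
      _ ≤ ∑ i, 16 * E i * C0 ^ 5 :=
          Finset.single_le_sum (f := fun i => 16 * E i * C0 ^ 5)
            (fun j _ => mul_nonneg (mul_nonneg (by norm_num) (hE j).le) (by positivity))
            (Finset.mem_univ i)
      _ ≤ _ := by linarith
  · intro hβ0 n hn ξ
    have hmean : ∫ x, g n x = 0 := by
      have he : MeasurableEmbedding (WithLp.ofLp : EuclideanSpace ℝ (Fin 4) → Fin 4 → ℝ) :=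
        (MeasurableEquiv.toLp 2 (Fin 4 → ℝ)).symm.measurableEmbedding
      simp only [hg]
      rw [integral_complex_ofReal,
        (PiLp.volume_preserving_ofLp (Fin 4)).integral_comp he (R n), hR.mean_zero hβ0 n hn,
        Complex.ofReal_zero]
    have h := norm_fourier_le_of_integral_eq_zero (by positivity) (hr0 n) (g n).integrable hmean
      (hgbd n) (hgbox n) ξ
    rw [mul_assoc, mul_assoc D, hr, two_rpow_mul_box, pow_zero, one_pow, hβ0, neg_zero,
      Real.rpow_zero, one_pow] at h
    rw [SchwartzMap.fourier_coe]
    refine h.trans ?_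
    have hterm : ∀ i, |ξ i| * (C0 * (2 : ℝ) ^ (-(n : ℝ))) ^ sExp i ≤
        (1 + C0) ^ 2 * (|ξ i| * (((2 : ℝ) ^ sExp i)⁻¹) ^ n) := by
      intro i
      have hs : sExp i ≤ 2 := by fin_cases i <;> simp [sExp]
      have h1 : C0 ^ sExp i ≤ (1 + C0) ^ 2 :=
        (pow_le_pow_left₀ hC0.le (by linarith) _).trans
          (pow_le_pow_right₀ (by linarith) hs)
      have h2 : (C0 * (2 : ℝ) ^ (-(n : ℝ))) ^ sExp i =
          C0 ^ sExp i * (((2 : ℝ) ^ sExp i)⁻¹) ^ n := by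
        rw [Real.rpow_neg zero_le_two, Real.rpow_natCast, mul_pow, inv_pow, inv_pow, ← pow_mul,
          ← pow_mul, mul_comm n]
      rw [h2]
      calc |ξ i| * (C0 ^ sExp i * (((2 : ℝ) ^ sExp i)⁻¹) ^ n)
          ≤ |ξ i| * ((1 + C0) ^ 2 * (((2 : ℝ) ^ sExp i)⁻¹) ^ n) := by gcongr
        _ = _ := by ring
    have hS : 0 ≤ ∑ i, |ξ i| * (((2 : ℝ) ^ sExp i)⁻¹) ^ n :=
      Finset.sum_nonneg fun i _ => by positivity
    calc (2 * Real.pi * ∑ i, |ξ i| * (C0 * (2 : ℝ) ^ (-(n : ℝ))) ^ sExp i) *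
          (D * (16 * C0 ^ 5 * 1 * 1))
        ≤ (2 * Real.pi * ∑ i, (1 + C0) ^ 2 * (|ξ i| * (((2 : ℝ) ^ sExp i)⁻¹) ^ n)) *
          (D * (16 * C0 ^ 5 * 1 * 1)) := by
          refine mul_le_mul_of_nonneg_right (mul_le_mul_of_nonneg_left
            (Finset.sum_le_sum fun i _ => hterm i) (by positivity)) (by positivity)
      _ = 2 * Real.pi * (1 + C0) ^ 2 * (16 * D * C0 ^ 5) *
          ∑ i, |ξ i| * (((2 : ℝ) ^ sExp i)⁻¹) ^ n := by
          rw [← Finset.mul_sum]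
          ring
      _ ≤ _ := by
          gcongr
          linarith

/-- The Fourier transforms of the kernels are absolutely summable, uniformly in the frequency. -/
lemma exists_sum_norm_fourier_le (hR : AssumptionR R β)
    {g : ℕ → 𝓢(EuclideanSpace ℝ (Fin 4), ℂ)} (hg : ∀ n x, g n x = (R n x.ofLp : ℂ)) :
    ∃ C, 0 < C ∧ ∀ N ξ, ∑ n ∈ Finset.range N, ‖𝓕 (g n) ξ‖ ≤ C := by
  obtain ⟨B, hB, hunif, hhigh, hlow⟩ := hR.exists_fourier_decay hg
  rcases hR.beta_nonneg.eq_or_lt with hβ | hβ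
  · refine ⟨B + 13 * B * 8 + 1, by positivity, fun N ξ => ?_⟩
    set p : ℕ → Fin 4 → ℝ := fun n i => |ξ i| * (((2 : ℝ) ^ sExp i)⁻¹) ^ n with hp
    have hp0 : ∀ n i, 0 ≤ p n i := fun n i => by positivity
    have hterm : ∀ n, ‖𝓕 (g n) ξ‖ ≤
        (if n = 0 then B else 0) + 13 * B * ∑ i, p n i / (1 + p n i) ^ 2 := by
      intro n
      have hq : 0 ≤ 13 * B * ∑ i, p n i / (1 + p n i) ^ 2 :=
        mul_nonneg (by positivity)
          (Finset.sum_nonneg fun i _ => div_nonneg (hp0 n i) (sq_nonneg _))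
      rcases Nat.eq_zero_or_pos n with hn | hn
      · subst hn
        have := hunif 0 ξ
        simp only [pow_zero, mul_one] at this
        simp only [if_true]
        linarith
      · rw [if_neg hn.ne', zero_add]
        exact le_sum_div_one_add_sq (norm_nonneg _) hB (hp0 n) (hlow hβ.symm n hn ξ)
          fun i => hhigh n ξ i
    have hhalf : ∀ i, ((2 : ℝ) ^ sExp i)⁻¹ ≤ 1 / 2 := by
      intro i
      fin_cases i <;> norm_num [sExp]
    calc ∑ n ∈ Finset.range N, ‖𝓕 (g n) ξ‖
        ≤ ∑ n ∈ Finset.range N,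
          ((if n = 0 then B else 0) + 13 * B * ∑ i, p n i / (1 + p n i) ^ 2) :=
          Finset.sum_le_sum fun n _ => hterm n
      _ = (∑ n ∈ Finset.range N, if n = 0 then B else 0) +
          13 * B * ∑ i, ∑ n ∈ Finset.range N, p n i / (1 + p n i) ^ 2 := by
          rw [Finset.sum_add_distrib, ← Finset.mul_sum, Finset.sum_comm]
      _ ≤ B + 13 * B * ∑ _i : Fin 4, 2 := by
          gcongr with i
          · rw [Finset.sum_ite_eq']
            split_ifs <;> simp [hB]
          · exact sum_div_one_add_sq_le (abs_nonneg _) (by positivity) (hhalf i) N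
      _ ≤ _ := by
          norm_num
  · have hq1 : (2 : ℝ) ^ (-β) < 1 :=
      Real.rpow_lt_one_of_one_lt_of_neg one_lt_two (neg_neg_of_pos hβ)
    have hq0 : (0 : ℝ) ≤ 2 ^ (-β) := by positivity
    have hsum := summable_geometric_of_lt_one hq0 hq1
    refine ⟨B * ∑' n : ℕ, ((2 : ℝ) ^ (-β)) ^ n + 1, ?_, fun N ξ => ?_⟩
    · have : 0 ≤ ∑' n : ℕ, ((2 : ℝ) ^ (-β)) ^ n := tsum_nonneg fun n => by positivity
      positivity
    · calc ∑ n ∈ Finset.range N, ‖𝓕 (g n) ξ‖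
          ≤ ∑ n ∈ Finset.range N, B * ((2 : ℝ) ^ (-β)) ^ n :=
            Finset.sum_le_sum fun n _ => hunif n ξ
        _ = B * ∑ n ∈ Finset.range N, ((2 : ℝ) ^ (-β)) ^ n := by rw [Finset.mul_sum]
        _ ≤ B * ∑' n : ℕ, ((2 : ℝ) ^ (-β)) ^ n := by
            gcongr
            exact hsum.sum_le_tsum _ fun n _ => by positivity
        _ ≤ _ := by linarith

end AssumptionR

lemma measurableSet_fundDom : MeasurableSet fundDom := by
  have : fundDom = ⋂ i : Fin 3, (fun z : Fin 4 → ℝ => z i.succ) ⁻¹' Set.Ico (0 : ℝ) 1 := by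
    ext z
    simp [fundDom]
  rw [this]
  exact MeasurableSet.iInter fun i => measurable_pi_apply _ measurableSet_Ico

/-- The `L²` norm of a periodic function on a spatial box is controlled by its `L²` norm on the
fundamental domain. -/
lemma exists_eLpNorm_indicator_box_le (M : ℕ) :
    ∃ c : ℕ, ∀ φ : (Fin 4 → ℝ) → ℝ, Measurable φ →
      (∀ (m : Fin 3 → ℤ) (z : Fin 4 → ℝ),
        φ (z + Fin.cons (0 : ℝ) (fun i => (m i : ℝ))) = φ z) →
      eLpNorm ({z | ∀ i : Fin 3, z i.succ ∈ Set.Ico (-(M : ℝ)) (M + 1)}.indicator φ) 2 volume ≤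
        c * eLpNorm φ 2 (volume.restrict fundDom) := by
  obtain ⟨S, hS⟩ : ∃ S : Finset (Fin 3 → ℤ), ∀ m : Fin 3 → ℤ,
      (∀ i, m i ∈ Finset.Icc (-(M : ℤ)) M) → m ∈ S :=
    ⟨Fintype.piFinset fun _ => Finset.Icc (-(M : ℤ)) M, fun _ hm => Fintype.mem_piFinset.2 hm⟩
  refine ⟨S.card, fun φ hφ hper => ?_⟩
  set u : (Fin 4 → ℝ) → ℝ := fundDom.indicator fun z => ‖φ z‖ with hu
  have hu0 : ∀ z, 0 ≤ u z := fun z => Set.indicator_nonneg (fun _ _ => norm_nonneg _) z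
  have hum : Measurable u := hφ.norm.indicator measurableSet_fundDom
  have hunorm : eLpNorm u 2 volume = eLpNorm φ 2 (volume.restrict fundDom) := by
    rw [hu, eLpNorm_indicator_eq_eLpNorm_restrict measurableSet_fundDom, eLpNorm_norm]
  let s : (Fin 3 → ℤ) → Fin 4 → ℝ := fun m => Fin.cons (0 : ℝ) fun i => (m i : ℝ)
  have hp : ∀ m, MeasurePreserving (fun z : Fin 4 → ℝ => z - s m) volume volume := fun m =>
    measurePreserving_sub_right volume (s m)
  have hshift : ∀ m ∈ S, eLpNorm (fun z => u (z - s m)) 2 volume =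
      eLpNorm φ 2 (volume.restrict fundDom) := fun m _ => by
    rw [← hunorm]
    change eLpNorm (u ∘ fun z => z - s m) 2 volume = _
    exact eLpNorm_comp_measurePreserving hum.aestronglyMeasurable (hp m)
  calc _ ≤ eLpNorm (∑ m ∈ S, fun z => u (z - s m)) 2 volume := by
        refine eLpNorm_mono_real fun z => ?_
        rw [Finset.sum_apply]
        by_cases hz : ∀ i : Fin 3, z i.succ ∈ Set.Ico (-(M : ℝ)) (M + 1)
        · rw [Set.indicator_of_mem (by exact hz)]
          set m : Fin 3 → ℤ := fun i => ⌊z i.succ⌋ with hm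
          have hmS : m ∈ S := by
            refine hS m fun i => ?_
            rw [Finset.mem_Icc]
            constructor
            · rw [hm, Int.le_floor]
              simpa using (hz i).1
            · rw [← Int.lt_add_one_iff, hm, Int.floor_lt]
              simpa using (hz i).2
          have hzD : z - s m ∈ fundDom := by
            intro i
            simp only [s, Pi.sub_apply, Fin.cons_succ, hm, Set.mem_Ico]
            exact ⟨sub_nonneg.2 (Int.floor_le _), by linarith [Int.lt_floor_add_one (z i.succ)]⟩
          have hφz : φ z = φ (z - s m) := by
            have := hper m (z - s m)
            rwa [sub_add_cancel] at this
          have huz : u (z - s m) = ‖φ z‖ := by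
            rw [hu, Set.indicator_of_mem hzD, hφz]
          rw [← huz]
          exact Finset.single_le_sum (f := fun m => u (z - s m)) (fun _ _ => hu0 _) hmS
        · rw [Set.indicator_of_notMem (by exact hz), norm_zero]
          exact Finset.sum_nonneg fun _ _ => hu0 _
    _ ≤ ∑ m ∈ S, eLpNorm (fun z => u (z - s m)) 2 volume :=
        eLpNorm_sum_le (fun m _ => (hum.comp (hp m).measurable).aestronglyMeasurable) one_le_two
    _ = S.card * eLpNorm φ 2 (volume.restrict fundDom) := by
        rw [Finset.sum_congr rfl hshift, Finset.sum_const, nsmul_eq_mul]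

/-- A uniform bound on the `L²` norms of the partial sums passes to the sum of a series, with no
convergence assumption. -/
lemma eLpNorm_tsum_le_of_forall_sum_range_le {α : Type*} [MeasurableSpace α] {μ : Measure α}
    {h : ℕ → α → ℝ} (hm : ∀ n, Measurable (h n)) {A : ℝ≥0∞}
    (hA : ∀ N, eLpNorm (fun z => ∑ n ∈ Finset.range N, h n z) 2 μ ≤ A) :
    eLpNorm (fun z => ∑' n, h n z) 2 μ ≤ A := by
  have hsq : ∀ w : α → ℝ, eLpNorm w 2 μ ^ 2 = ∫⁻ z, ‖w z‖ₑ ^ 2 ∂μ := fun w => by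
    simpa using eLpNorm_nnreal_pow_eq_lintegral (f := w) (μ := μ) (p := 2) two_ne_zero
  rw [← ENNReal.pow_le_pow_left_iff two_ne_zero, hsq]
  calc ∫⁻ z, ‖∑' n, h n z‖ₑ ^ 2 ∂μ
      ≤ ∫⁻ z, liminf (fun N => ‖∑ n ∈ Finset.range N, h n z‖ₑ ^ 2) atTop ∂μ := by
        refine lintegral_mono fun z => ?_
        by_cases hz : Summable fun n => h n z
        · have ht := hz.hasSum.tendsto_sum_nat
          exact ((ENNReal.continuous_pow 2).tendsto _ |>.comp ht.enorm).liminf_eq.ge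
        · simp [tsum_eq_zero_of_not_summable hz]
    _ ≤ liminf (fun N => ∫⁻ z, ‖∑ n ∈ Finset.range N, h n z‖ₑ ^ 2 ∂μ) atTop :=
        lintegral_liminf_le fun N =>
          (Finset.measurable_fun_sum _ fun n _ => hm n).enorm.pow_const 2
    _ ≤ A ^ 2 := by
        refine (liminf_le_liminf (v := fun _ => A ^ 2) (Eventually.of_forall fun N => ?_)).trans
          (by simp)
        rw [← hsq]
        gcongr
        exact hA N

namespace AssumptionR

variable {R : ℕ → (Fin 4 → ℝ) → ℝ} {β : ℝ}

/-- Partial sums of the convolution operators are uniformly bounded on `L²(ℝ⁴)`. -/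
lemma exists_eLpNorm_sum_convolution_le (hR : AssumptionR R β) :
    ∃ C, 0 < C ∧ ∀ f : (Fin 4 → ℝ) → ℝ, MemLp f 2 volume → ∀ N : ℕ,
      eLpNorm (fun z => ∑ n ∈ Finset.range N, ∫ y, R n y * f (z - y)) 2 volume ≤
        ENNReal.ofReal C * eLpNorm f 2 volume := by
  obtain ⟨g, hg⟩ := hR.exists_schwartz
  obtain ⟨C, hC, hsum⟩ := hR.exists_sum_norm_fourier_le hg
  refine ⟨C, hC, fun f hf N => ?_⟩
  have hRm : ∀ n, MemLp (R n) 2 volume := by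
    intro n
    have h := ((g n).memLp 2 volume).comp_measurePreserving (PiLp.volume_preserving_toLp (Fin 4))
    have hre : R n = fun z => RCLike.re ((g n ∘ WithLp.toLp 2) z) := by
      ext z
      simp [hg]
    rw [hre]
    exact h.re
  have hint : ∀ n z, Integrable fun y => R n y * f (z - y) := fun n z =>
    (hRm n).integrable_mul
      (hf.comp_measurePreserving (Measure.measurePreserving_sub_left volume z))
  have hfun : (fun z => ∑ n ∈ Finset.range N, ∫ y, R n y * f (z - y)) =
      fun z => ∫ y, (∑ n ∈ Finset.range N, R n y) * f (z - y) := by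
    ext z
    rw [← integral_finsetSum _ fun n _ => hint n z]
    simp only [Finset.sum_mul]
  rw [hfun]
  refine eLpNorm_convolution_pi_le (∑ n ∈ Finset.range N, g n) (fun ξ => ?_) (fun x => ?_) hf
  · have : 𝓕 (∑ n ∈ Finset.range N, g n) = ∑ n ∈ Finset.range N, 𝓕 (g n) :=
      map_sum (FourierTransform.fourierCLM ℂ 𝓢(EuclideanSpace ℝ (Fin 4), ℂ)) g _
    rw [this, sum_apply]
    exact (norm_sum_le _ _).trans (hsum N ξ)
  · rw [sum_apply]
    simp [hg]

end AssumptionR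

/-- Proposition 2.2 of the paper.  Under Assumption R, the operator
φ ↦ R * φ = ∑ₙ Rₙ * φ is bounded on L²(ℝ × 𝕋³): there is C > 0 such that for every
measurable, spatially periodic φ which is square integrable on a fundamental domain,
the L² norm of R * φ is at most C times the L² norm of φ. -/
theorem stmt0 (R : ℕ → (Fin 4 → ℝ) → ℝ) (β : ℝ) (hR : AssumptionR R β) :
    ∃ C > 0, ∀ φ : (Fin 4 → ℝ) → ℝ, Measurable φ →
      (∀ (m : Fin 3 → ℤ) (z : Fin 4 → ℝ),
        φ (z + Fin.cons (0 : ℝ) (fun i => (m i : ℝ))) = φ z) →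
      eLpNorm φ 2 (volume.restrict fundDom) < ⊤ →
      eLpNorm (fun z => ∑' n : ℕ, ∫ y : Fin 4 → ℝ, R n y * φ (z - y)) 2
          (volume.restrict fundDom) ≤
        ENNReal.ofReal C * eLpNorm φ 2 (volume.restrict fundDom) := by
  obtain ⟨C, hC, hbound⟩ := hR.exists_eLpNorm_sum_convolution_le
  obtain ⟨C0, hC0, hsupp⟩ := hR.support
  obtain ⟨M, hM⟩ := exists_nat_ge C0
  obtain ⟨c, hc⟩ := exists_eLpNorm_indicator_box_le M
  refine ⟨C * c + 1, by positivity, fun φ hφ hper hfin => ?_⟩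
  set box : Set (Fin 4 → ℝ) := {z | ∀ i : Fin 3, z i.succ ∈ Set.Ico (-(M : ℝ)) (M + 1)} with hbox
  have hboxm : MeasurableSet box := by
    have : box = ⋂ i : Fin 3, (fun z : Fin 4 → ℝ => z i.succ) ⁻¹' Set.Ico (-(M : ℝ)) (M + 1) := by
      ext z
      simp [hbox]
    rw [this]
    exact MeasurableSet.iInter fun i => measurable_pi_apply _ measurableSet_Ico
  have hle := hc φ hφ hper
  have hf : MemLp (box.indicator φ) 2 volume :=
    ⟨(hφ.indicator hboxm).aestronglyMeasurable,
      hle.trans_lt (ENNReal.mul_lt_top (ENNReal.natCast_lt_top c) hfin)⟩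
  have hlocal : ∀ n, ∀ z ∈ fundDom,
      ∫ y, R n y * φ (z - y) = ∫ y, R n y * box.indicator φ (z - y) := by
    intro n z hz
    congr 1
    ext y
    by_cases hy : R n y = 0
    · simp [hy]
    · have hmem : z - y ∈ box := by
        intro i
        have h1 : |y i.succ| ≤ C0 * (2 : ℝ) ^ (-(n : ℝ)) := by
          have := abs_le_of_snorm4_le (by positivity) (hsupp n y hy) i.succ
          have hs : sExp i.succ = 1 := by fin_cases i <;> rfl
          rwa [hs, pow_one] at this
        have h2 : (2 : ℝ) ^ (-(n : ℝ)) ≤ 1 :=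
          Real.rpow_le_one_of_one_le_of_nonpos one_le_two (neg_nonpos.2 n.cast_nonneg)
        have h3 : |y i.succ| ≤ M := by nlinarith
        have h4 := abs_le.1 h3
        have h5 := hz i
        rw [Set.mem_Ico] at h5
        rw [Pi.sub_apply, Set.mem_Ico]
        constructor <;> linarith
      rw [Set.indicator_of_mem hmem]
  refine eLpNorm_tsum_le_of_forall_sum_range_le (fun n => ?_) fun N => ?_
  · have hm : StronglyMeasurable fun p : (Fin 4 → ℝ) × (Fin 4 → ℝ) =>
        R n p.2 * φ (p.1 - p.2) :=
      (((hR.smooth n).continuous.measurable.comp measurable_snd).mul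
        (hφ.comp (measurable_fst.sub measurable_snd))).stronglyMeasurable
    exact hm.integral_prod_right'.measurable
  · calc eLpNorm (fun z => ∑ n ∈ Finset.range N, ∫ y, R n y * φ (z - y)) 2
          (volume.restrict fundDom)
        = eLpNorm (fun z => ∑ n ∈ Finset.range N, ∫ y, R n y * box.indicator φ (z - y)) 2
          (volume.restrict fundDom) := by
          refine eLpNorm_congr_ae ?_
          filter_upwards [ae_restrict_mem measurableSet_fundDom] with z hz
          exact Finset.sum_congr rfl fun n _ => hlocal n z hz
      _ ≤ eLpNorm (fun z => ∑ n ∈ Finset.range N, ∫ y, R n y * box.indicator φ (z - y)) 2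
          volume := eLpNorm_restrict_le _ _ _ _
      _ ≤ ENNReal.ofReal C * (c * eLpNorm φ 2 (volume.restrict fundDom)) :=
          (hbound _ hf N).trans (by gcongr)
      _ = ENNReal.ofReal (C * c) * eLpNorm φ 2 (volume.restrict fundDom) := by
          rw [ENNReal.ofReal_mul hC.le, ENNReal.ofReal_natCast, mul_assoc]
      _ ≤ _ := by
          gcongr
          linarith
end
end

section
/- Let \beta \ge 0. Let \rho be a smooth, even, compactly supported function on \mathbb{R}^4 with \int_{\mathbb{R}^4}\rho = 1, set \eta(x) = \rho(x) - 2^{-|s|}\rho(2^{-1}\cdot x), and assume there exists \xi_0\in\mathbb{R}^4 such that |\hat{\eta}(\xi_0)| - \sum_{n\in\mathbb{Z}\setminus\{0\}} 2^{-n\beta}|\hat{\eta}(2^{-n}\cdot\xi_0)| > 0. Let (\alpha_n)_{n\ge 0} be a bounded real sequence with \limsup_{n\to\infty} 2^{n\beta}|\alpha_n| < \infty. Then the family given by R_0 = \alpha_0\rho and R_n = \alpha_n\,\eta^{2^{-n}} for n \ge 1 (where \eta^{\lambda}(y) = \lambda^{-|s|}\eta(\lambda^{-1}\cdot y)) satisfies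 Assumption R with parameter \beta. -/
open MeasureTheory Filter Topology

noncomputable section

/-- The family R₀ = α₀ ρ, Rₙ = αₙ η^(2^(-n)) for n ≥ 1, where
η^λ(y) = λ^(-|s|) η(λ⁻¹ · y), i.e. η^(2^(-n))(y) = 2^(5n) η(2ⁿ · y). -/
def famPL (α : ℕ → ℝ) (ρ η : (Fin 4 → ℝ) → ℝ) : ℕ → (Fin 4 → ℝ) → ℝ :=
  fun n => if n = 0 then (fun z => α 0 * ρ z)
    else (fun z => α n * ((2 : ℝ) ^ (5 * n) * η (scl ((2 : ℝ) ^ n) z)))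

/-- The parabolic scaling by `l` as a continuous linear map. -/
def sclCLM (l : ℝ) : (Fin 4 → ℝ) →L[ℝ] (Fin 4 → ℝ) :=
  ContinuousLinearMap.pi fun i => l ^ sExp i • ContinuousLinearMap.proj i

lemma coe_sclCLM (l : ℝ) : ⇑(sclCLM l) = scl l := by
  ext z i
  simp [sclCLM, scl]

lemma contDiff_scl (l : ℝ) : ContDiff ℝ (⊤ : ℕ∞) (scl l) :=
  coe_sclCLM l ▸ (sclCLM l).contDiff

lemma scl_neg (l : ℝ) (z : Fin 4 → ℝ) : scl l (-z) = -scl l z := by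
  ext i
  simp [scl]

lemma scl_one (z : Fin 4 → ℝ) : scl 1 z = z := by
  ext i
  simp [scl]

lemma scl_scl (a b : ℝ) (z : Fin 4 → ℝ) : scl a (scl b z) = scl (a * b) z := by
  ext i
  simp only [scl, mul_pow]
  ring

lemma sExp_pos (i : Fin 4) : 0 < sExp i := by
  fin_cases i <;> simp [sExp]

lemma snorm4_scl {l : ℝ} (hl : 0 ≤ l) (z : Fin 4 → ℝ) : snorm4 (scl l z) = l * snorm4 z := by
  simp only [snorm4, scl, Real.mul_iSup_of_nonneg hl]
  congr 1
  ext i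
  rw [abs_mul, abs_of_nonneg (pow_nonneg hl _), Real.mul_rpow (pow_nonneg hl _) (abs_nonneg _),
    Real.pow_rpow_inv_natCast hl (sExp_pos i).ne']

lemma HasCompactSupport.exists_snorm4_le {f : (Fin 4 → ℝ) → ℝ} (hf : HasCompactSupport f) :
    ∃ C > 0, ∀ z, f z ≠ 0 → snorm4 z ≤ C := by
  obtain ⟨r, hr⟩ := hf.isCompact.isBounded.exists_norm_le
  refine ⟨max r 1, by positivity, fun z hz => ciSup_le fun i => ?_⟩
  have hi : |z i| ≤ max r 1 :=
    (norm_le_pi_norm z i).trans ((hr z (subset_tsupport f hz)).trans (le_max_left _ _))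
  have hs : ((sExp i : ℝ)⁻¹) ≤ 1 := inv_le_one_of_one_le₀ (by exact_mod_cast sExp_pos i)
  calc |z i| ^ ((sExp i : ℝ)⁻¹) ≤ max r 1 ^ ((sExp i : ℝ)⁻¹) :=
        Real.rpow_le_rpow (abs_nonneg _) hi (by positivity)
    _ ≤ max r 1 ^ (1 : ℝ) := Real.rpow_le_rpow_of_exponent_le (le_max_right _ _) hs
    _ = max r 1 := Real.rpow_one _

lemma HasCompactSupport.comp_scl {f : (Fin 4 → ℝ) → ℝ} (hf : HasCompactSupport f)
    {l : ℝ} (hl : l ≠ 0) : HasCompactSupport fun z => f (scl l z) := by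
  refine HasCompactSupport.intro (hf.isCompact.image (contDiff_scl l⁻¹).continuous)
    fun z hz => ?_
  by_contra h
  exact hz ⟨scl l z, subset_tsupport f h, by rw [scl_scl, inv_mul_cancel₀ hl, scl_one]⟩

lemma pow_mul_integral_comp_scl {f : (Fin 4 → ℝ) → ℝ} (hf : Continuous f) {l : ℝ} (hl : 0 < l) :
    l ^ 5 * ∫ z, f (scl l z) = ∫ z, f z := by
  have hdet : (Matrix.diagonal fun i => l ^ sExp i).det = l ^ 5 := by
    rw [Matrix.det_diagonal, Finset.prod_pow_eq_pow_sum]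
    simp [Fin.sum_univ_four, sExp]
  have hcoe : ⇑(Matrix.toLin' (Matrix.diagonal fun i => l ^ sExp i)) = scl l := by
    ext z i
    simp [Matrix.mulVec_diagonal, scl]
  have h := Real.smul_map_diagonal_volume_pi (D := fun i => l ^ sExp i)
    (by rw [hdet]; positivity)
  rw [hdet, hcoe] at h
  conv_rhs => rw [← h]
  rw [integral_smul_measure, ENNReal.toReal_ofReal (abs_nonneg _), abs_of_pos (by positivity),
    integral_map (contDiff_scl l).continuous.aemeasurable hf.aestronglyMeasurable, smul_eq_mul]

lemma ContDiff.pderiv1 {f : (Fin 4 → ℝ) → ℝ} (hf : ContDiff ℝ (⊤ : ℕ∞) f) (i : Fin 4) :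
    ContDiff ℝ (⊤ : ℕ∞) (pderiv1 i f) :=
  (hf.fderiv_right (by simp)).clm_apply contDiff_const

lemma ContDiff.iterate_pderiv1 {f : (Fin 4 → ℝ) → ℝ} (hf : ContDiff ℝ (⊤ : ℕ∞) f) (i : Fin 4)
    (m : ℕ) : ContDiff ℝ (⊤ : ℕ∞) ((_root_.pderiv1 i)^[m] f) := by
  induction m with
  | zero => exact hf
  | succ m ih => rw [Function.iterate_succ_apply']; exact ih.pderiv1 i

lemma ContDiff.pderivM {f : (Fin 4 → ℝ) → ℝ} (hf : ContDiff ℝ (⊤ : ℕ∞) f) (k : Fin 4 → ℕ) :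
    ContDiff ℝ (⊤ : ℕ∞) (pderivM k f) :=
  (((hf.iterate_pderiv1 3 _).iterate_pderiv1 2 _).iterate_pderiv1 1 _).iterate_pderiv1 0 _

lemma HasCompactSupport.iterate_pderiv1 {f : (Fin 4 → ℝ) → ℝ} (hf : HasCompactSupport f)
    (i : Fin 4) (m : ℕ) : HasCompactSupport ((pderiv1 i)^[m] f) := by
  induction m with
  | zero => exact hf
  | succ m ih => rw [Function.iterate_succ_apply']; exact ih.fderiv_apply ℝ _

lemma HasCompactSupport.pderivM {f : (Fin 4 → ℝ) → ℝ} (hf : HasCompactSupport f)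
    (k : Fin 4 → ℕ) : HasCompactSupport (pderivM k f) :=
  (((hf.iterate_pderiv1 3 _).iterate_pderiv1 2 _).iterate_pderiv1 1 _).iterate_pderiv1 0 _

lemma exists_abs_pderivM_le {f : (Fin 4 → ℝ) → ℝ} (hf : ContDiff ℝ (⊤ : ℕ∞) f)
    (hsupp : HasCompactSupport f) (k : Fin 4 → ℕ) : ∃ D, ∀ z, |pderivM k f z| ≤ D :=
  (hsupp.pderivM k).exists_bound_of_continuous (hf.pderivM k).continuous

lemma pderiv1_const_mul_comp_scl {f : (Fin 4 → ℝ) → ℝ} (hf : ContDiff ℝ (⊤ : ℕ∞) f)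
    (c l : ℝ) (i : Fin 4) :
    pderiv1 i (fun z => c * f (scl l z)) = fun z => c * l ^ sExp i * pderiv1 i f (scl l z) := by
  ext z
  have h : HasFDerivAt (fun z => c * f (scl l z)) (c • (fderiv ℝ f (scl l z)).comp (sclCLM l)) z :=
    ((hf.differentiable (by simp) (scl l z)).hasFDerivAt.comp z
      (coe_sclCLM l ▸ (sclCLM l).hasFDerivAt)).const_mul c
  have hsingle : scl l (Pi.single i 1) = l ^ sExp i • Pi.single i (1 : ℝ) := by
    ext j
    by_cases hj : j = i
    · subst hj; simp [scl]
    · simp [scl, hj]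
  simp only [pderiv1, h.fderiv, smul_apply, ContinuousLinearMap.comp_apply,
    coe_sclCLM, hsingle, map_smul, smul_eq_mul]
  ring

lemma iterate_pderiv1_const_mul_comp_scl {f : (Fin 4 → ℝ) → ℝ} (hf : ContDiff ℝ (⊤ : ℕ∞) f)
    (c l : ℝ) (i : Fin 4) (m : ℕ) :
    (pderiv1 i)^[m] (fun z => c * f (scl l z)) =
      fun z => c * l ^ (sExp i * m) * (pderiv1 i)^[m] f (scl l z) := by
  induction m with
  | zero => simp
  | succ m ih =>
    rw [Function.iterate_succ_apply', ih, pderiv1_const_mul_comp_scl (hf.iterate_pderiv1 i m)]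
    simp only [Function.iterate_succ_apply', mul_add, mul_one, pow_add, mul_assoc]

lemma pderivM_const_mul_comp_scl {f : (Fin 4 → ℝ) → ℝ} (hf : ContDiff ℝ (⊤ : ℕ∞) f)
    (c l : ℝ) (k : Fin 4 → ℕ) :
    pderivM k (fun z => c * f (scl l z)) =
      fun z => c * l ^ (∑ i, sExp i * k i) * pderivM k f (scl l z) := by
  have h3 := hf.iterate_pderiv1 3 (k 3)
  have h2 := h3.iterate_pderiv1 2 (k 2)
  have h1 := h2.iterate_pderiv1 1 (k 1)
  ext z
  simp only [pderivM, Function.comp_apply, iterate_pderiv1_const_mul_comp_scl hf,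
    iterate_pderiv1_const_mul_comp_scl h3, iterate_pderiv1_const_mul_comp_scl h2,
    iterate_pderiv1_const_mul_comp_scl h1, Fin.sum_univ_four, pow_add]
  ring

lemma famPL_eq (α : ℕ → ℝ) (ρ η : (Fin 4 → ℝ) → ℝ) (n : ℕ) :
    famPL α ρ η n =
      fun z => α n * 2 ^ (5 * n) * (if n = 0 then ρ else η) (scl ((2 : ℝ) ^ n) z) := by
  rcases eq_or_ne n 0 with rfl | hn
  · simp [famPL, scl_one]
  · simp [famPL, hn, mul_assoc]

lemma exists_forall_le_of_limsup_ofReal_lt_top {u : ℕ → ℝ}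
    (hu : atTop.limsup (fun n => ENNReal.ofReal (u n)) < ⊤) : ∃ B > 0, ∀ n, u n ≤ B := by
  obtain ⟨b, hb, hb'⟩ := exists_between hu
  obtain ⟨N, hN⟩ := eventually_atTop.1 (eventually_lt_of_limsup_lt hb)
  obtain ⟨D, hD⟩ := ((Set.finite_lt_nat N).image u).bddAbove
  refine ⟨max (max D b.toReal) 1, by positivity, fun n => ?_⟩
  rcases lt_or_ge n N with h | h
  · exact (hD ⟨n, h, rfl⟩).trans ((le_max_left _ _).trans (le_max_left _ _))
  · have := (ENNReal.ofReal_le_iff_le_toReal hb'.ne).1 (hN n h).le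
    exact this.trans ((le_max_right _ _).trans (le_max_left _ _))

/-- part of Proposition 2.5 of the paper.  Let ρ be smooth, even,
compactly supported with ∫ ρ = 1, let η(x) = ρ(x) - 2^(-|s|) ρ(2⁻¹ · x), and assume the
non-degeneracy condition at some ξ₀.  If (αₙ) is bounded and limsup 2^(nβ)|αₙ| < ∞, then
the family (α₀ρ, αₙ η^(2^(-n))) satisfies Assumption R with parameter β. -/
theorem stmt2 (β : ℝ) (hβ : 0 ≤ β)
    (ρ : (Fin 4 → ℝ) → ℝ) (hρsmooth : ContDiff ℝ (⊤ : ℕ∞) ρ)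
    (hρeven : ∀ z, ρ (-z) = ρ z) (hρsupp : HasCompactSupport ρ)
    (hρint : (∫ z, ρ z) = 1)
    (η : (Fin 4 → ℝ) → ℝ)
    (hη : η = fun x => ρ x - ((2 : ℝ) ^ (5 : ℕ))⁻¹ * ρ (scl (2⁻¹ : ℝ) x))
    (ξ0 : Fin 4 → ℝ)
    (hξ0 : 0 < ‖ft η ξ0‖ -
      ∑' n : {m : ℤ // m ≠ 0},
        (2 : ℝ) ^ (-((n : ℤ) : ℝ) * β) * ‖ft η (scl ((2 : ℝ) ^ (-((n : ℤ) : ℝ))) ξ0)‖)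
    (α : ℕ → ℝ) (hα : ∃ M : ℝ, ∀ n, |α n| ≤ M)
    (hαβ : Filter.atTop.limsup
        (fun n : ℕ => ENNReal.ofReal ((2 : ℝ) ^ ((n : ℝ) * β) * |α n|)) < ⊤) :
    AssumptionR (famPL α ρ η) β := by
  have hηsmooth : ContDiff ℝ (⊤ : ℕ∞) η := by
    rw [hη]
    exact hρsmooth.sub (contDiff_const.mul (hρsmooth.comp (contDiff_scl _)))
  have hρ2supp : HasCompactSupport fun x => ρ (scl (2⁻¹ : ℝ) x) :=
    hρsupp.comp_scl (by norm_num)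
  have hηsupp : HasCompactSupport η := by
    rw [hη]
    exact hρsupp.sub (hρ2supp.mul_left (f := fun _ => ((2 : ℝ) ^ (5 : ℕ))⁻¹))
  have hηeven : ∀ z, η (-z) = η z := fun z => by simp only [hη, scl_neg, hρeven]
  have hηint : ∫ z, η z = 0 := by
    have hρ2 : Continuous fun x => ρ (scl (2⁻¹ : ℝ) x) :=
      hρsmooth.continuous.comp (contDiff_scl _).continuous
    rw [hη, integral_sub (hρsmooth.continuous.integrable_of_hasCompactSupport hρsupp)
      ((hρ2.integrable_of_hasCompactSupport hρ2supp).const_mul _), integral_const_mul,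
      ← inv_pow, pow_mul_integral_comp_scl hρsmooth.continuous (by norm_num), sub_self]
  set F : ℕ → (Fin 4 → ℝ) → ℝ := fun n => if n = 0 then ρ else η
  have hFcases : ∀ n, F n = ρ ∨ F n = η := fun n => ite_eq_or_eq _ _ _
  have hFsmooth : ∀ n, ContDiff ℝ (⊤ : ℕ∞) (F n) := fun n => by
    rcases hFcases n with h | h <;> rwa [h]
  have hfam : ∀ n, famPL α ρ η n = fun z => α n * 2 ^ (5 * n) * F n (scl ((2 : ℝ) ^ n) z) :=
    famPL_eq α ρ η
  refine ⟨hβ, fun n z => ?_, fun n => ?_, ?_, fun k => ?_, fun _ n hn => ?_⟩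
  · simp only [hfam, scl_neg]
    rcases hFcases n with h | h <;> simp only [h, hρeven, hηeven]
  · rw [hfam]
    exact contDiff_const.mul ((hFsmooth n).comp (contDiff_scl _))
  · obtain ⟨C, hC, hCρ⟩ := hρsupp.exists_snorm4_le
    obtain ⟨C', hC', hCη⟩ := hηsupp.exists_snorm4_le
    refine ⟨max C C', lt_max_of_lt_left hC, fun n z hz => ?_⟩
    rw [hfam] at hz
    have hz' := right_ne_zero_of_mul hz
    have hle : snorm4 (scl ((2 : ℝ) ^ n) z) ≤ max C C' := by
      rcases hFcases n with h | h <;> rw [h] at hz'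
      · exact (hCρ _ hz').trans (le_max_left _ _)
      · exact (hCη _ hz').trans (le_max_right _ _)
    rw [snorm4_scl (by positivity)] at hle
    rw [Real.rpow_neg (by norm_num), Real.rpow_natCast, ← div_eq_mul_inv,
      le_div_iff₀ (by positivity), mul_comm]
    exact hle
  · obtain ⟨B, hB, hαB⟩ := exists_forall_le_of_limsup_ofReal_lt_top hαβ
    obtain ⟨D, hD⟩ := exists_abs_pderivM_le hρsmooth hρsupp k
    obtain ⟨D', hD'⟩ := exists_abs_pderivM_le hηsmooth hηsupp k
    set E := max (max D D') 1
    have hE : ∀ n z, |pderivM k (F n) z| ≤ E := fun n z => by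
      rcases hFcases n with h | h <;> rw [h]
      · exact (hD z).trans ((le_max_left _ _).trans (le_max_left _ _))
      · exact (hD' z).trans ((le_max_right _ _).trans (le_max_left _ _))
    refine ⟨B * E, by positivity, fun n z => ?_⟩
    have hpow : (2 : ℝ) ^ ((n : ℝ) * (5 + ksize k - β)) * 2 ^ ((n : ℝ) * β) =
        2 ^ (5 * n) * (2 ^ n) ^ (∑ i, sExp i * k i) := by
      rw [← Real.rpow_add (by norm_num), ← pow_mul, ← pow_add, ← Real.rpow_natCast]
      congr 1
      push_cast [ksize]
      ring
    rw [hfam, pderivM_const_mul_comp_scl (hFsmooth n), abs_mul, mul_assoc, ← hpow, abs_mul,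
      abs_of_pos (a := (2 : ℝ) ^ _ * 2 ^ _) (by positivity)]
    calc |α n| * (2 ^ ((n : ℝ) * (5 + ksize k - β)) * 2 ^ ((n : ℝ) * β)) * |pderivM k (F n) _|
        = (2 ^ ((n : ℝ) * β) * |α n|) * |pderivM k (F n) (scl ((2 : ℝ) ^ n) z)| *
            2 ^ ((n : ℝ) * (5 + ksize k - β)) := by ring
      _ ≤ B * E * 2 ^ ((n : ℝ) * (5 + ksize k - β)) := by
        gcongr
        · exact hαB n
        · exact hE n _
  · have hFn : F n = η := if_neg (by omega)
    simp only [hfam, hFn, integral_const_mul, mul_assoc]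
    rw [pow_mul', pow_mul_integral_comp_scl hηsmooth.continuous (by positivity), hηint, mul_zero]
end
end
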